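/- Let b > 1 and n ∈ ℕ. The unique best d_1-approximation of the Benford measure β_b among probability measures with at most n atoms is δ_x^p, where x_j = (1 + ((j−1)/n)(√b − 1)) · (1 + (j/n)(√b − 1)) and P_j = (2/log b) · log(1 + (j/n)(√b − 1)) for j = 1,…,n; in particular the support has exactly n points. Moreover d_1(β_b, δ_x^p) = (1/(n log b)) · tanh(log b/4). -/

import Mathlib

open MeasureTheory Filter Set

noncomputable section

namespace BenfordApprox

/-- Right-hand limit `f₊` of a nondecreasing `f : ℝ → ℝ̄`, at an extended-real point. -/
def fplus (f : ℝ → EReal) (a : EReal) : EReal := sInf (f '' {x : ℝ | a < (x : EReal)})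

/-- Left-hand limit `f₋` of a nondecreasing `f : ℝ → ℝ̄`, at an extended-real point. -/
def fminus (f : ℝ → EReal) (a : EReal) : EReal := sSup (f '' {x : ℝ | (x : EReal) < a})

/-- The (upper) inverse function `f⁻¹(t) = sup {x : f x ≤ t}` (with `sup ∅ = ⊥`). -/
def upperInv (f : ℝ → EReal) (t : ℝ) : EReal :=
  sSup ((fun x : ℝ => (x : EReal)) '' {x : ℝ | f x ≤ (t : EReal)})

/-- The upper inverse, for an extended-real argument. -/
def upperInvE (f : ℝ → EReal) (t : EReal) : EReal :=
  sSup ((fun x : ℝ => (x : EReal)) '' {x : ℝ | f x ≤ t})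

/-- Lévy-type distance `d_L(f,g)` between nondecreasing functions `f g : ℝ → ℝ̄`. -/
def dLfun (f g : ℝ → EReal) : EReal :=
  sInf ((fun y : ℝ => (y : EReal)) ''
    {y : ℝ | 0 ≤ y ∧ ∀ x : ℝ, f (x - y) - (y : EReal) ≤ g x ∧ g x ≤ f (x + y) + (y : EReal)})

/-- The auxiliary function `ℓ_{f,I}`; it depends on `I` only through `lo = inf I`, `hi = sup I`. -/
def ell (f : ℝ → EReal) (lo hi : EReal) (x : ℝ) : ℝ :=
  sInf {y : ℝ | 0 ≤ y ∧ fminus f (hi - (y : EReal)) - (y : EReal) ≤ (x : EReal) ∧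
    (x : EReal) ≤ fplus f (lo + (y : EReal)) + (y : EReal)}

/-- The minimal value `ℓ*_{f,I} = min {y ≥ 0 : f₋(sup I − y) − y ≤ f₊(inf I + y) + y}`. -/
def ellStar (f : ℝ → EReal) (lo hi : EReal) : ℝ :=
  sInf {y : ℝ | 0 ≤ y ∧
    fminus f (hi - (y : EReal)) - (y : EReal) ≤ fplus f (lo + (y : EReal)) + (y : EReal)}

/-- Distribution function `F_μ(t) = μ {y ∈ 𝕀 : y ≤ t}` of `μ`, where `𝕀 = [A,B]`. -/
def cdf (μ : Measure ℝ) (A B : ℝ) (t : ℝ) : ℝ := (μ (Icc A B ∩ Iic t)).toReal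

/-- `F_μ` evaluated at an extended-real point (so `F_μ(−∞) = 0`, `F_μ(+∞) = 1`). -/
def cdfE (μ : Measure ℝ) (A B : ℝ) (a : EReal) : ℝ :=
  (μ (Icc A B ∩ {y : ℝ | (y : EReal) ≤ a})).toReal

/-- Left limit `F_{μ−}` at an extended-real point (so `F_{μ−}(−∞) = 0`, `F_{μ−}(+∞) = 1`). -/
def cdfL (μ : Measure ℝ) (A B : ℝ) (a : EReal) : ℝ :=
  sSup ((cdf μ A B) '' {t : ℝ | (t : EReal) < a})

/-- Left limit `F_{μ−}` at a real point. -/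
def cdfm (μ : Measure ℝ) (A B : ℝ) (t : ℝ) : ℝ := sSup ((cdf μ A B) '' Iio t)

/-- The (upper) quantile function `F_μ⁻¹` of `μ` on `𝕀 = [A,B]`, extended monotonically to `ℝ`. -/
def quant (μ : Measure ℝ) (A B : ℝ) (t : ℝ) : ℝ :=
  if t < (μ {A}).toReal ∨ t < 0 then A
  else sSup {y ∈ Icc A B | cdf μ A B y ≤ t}

/-- Left limit `F⁻¹_{μ−}` of the quantile function. -/
def quantm (μ : Measure ℝ) (A B : ℝ) (t : ℝ) : ℝ := sSup ((quant μ A B) '' Iio t)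

/-- `F_μ` as a function into the extended reals. -/
def cdfEReal (μ : Measure ℝ) (A B : ℝ) : ℝ → EReal := fun t => ((cdf μ A B t : ℝ) : EReal)

/-- `F_μ⁻¹` as a function into the extended reals. -/
def quantEReal (μ : Measure ℝ) (A B : ℝ) : ℝ → EReal := fun t => ((quant μ A B t : ℝ) : EReal)

/-- The finitely supported measure `δ_x^p = Σ_j p_j δ_{x_j}`. -/
def discr (n : ℕ) (x p : Fin n → ℝ) : Measure ℝ :=
  ∑ j : Fin n, ENNReal.ofReal (p j) • Measure.dirac (x j)

/-- `p ∈ Π_n`: a probability vector. -/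
def IsPi (n : ℕ) (p : Fin n → ℝ) : Prop := (∀ j, 0 ≤ p j) ∧ ∑ j, p j = 1

/-- `x ∈ Ξ_n`: a nondecreasing vector of locations in `𝕀 = [A,B]`. -/
def IsXi (A B : ℝ) (n : ℕ) (x : Fin n → ℝ) : Prop := (∀ j, x j ∈ Icc A B) ∧ Monotone x

/-- The uniform weight vector `u_n = (1/n, …, 1/n)`. -/
def unif (n : ℕ) : Fin n → ℝ := fun _ => 1 / (n : ℝ)

/-- Partial sums `P_i = Σ_{j<i} p_j` (so `P_0 = 0`, `P_n = 1`). -/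
def psum (n : ℕ) (p : Fin n → ℝ) (i : ℕ) : ℝ := ∑ j : Fin n, if (j : ℕ) < i then p j else 0

/-- Locations extended by `x_0 = −∞`, `x_{n+1} = +∞`; here `extPts n x j` is the paper's `x_j`. -/
def extPts (n : ℕ) (x : Fin n → ℝ) : ℕ → EReal := fun j =>
  if hj : j = 0 then ⊥ else if h : j ≤ n then ((x ⟨j - 1, by omega⟩ : ℝ) : EReal) else ⊤

/-- `xcoord n x j` is the paper's `x_{j+1}` (0-based access). -/
def xcoord (n : ℕ) (x : Fin n → ℝ) (j : ℕ) : ℝ := if h : j < n then x ⟨j, h⟩ else 0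

/-- The normalizing constant `ω = max{1, λ(𝕀)}/λ(𝕀)` for `𝕀 = [A,B]`. -/
def omegaI (A B : ℝ) : ℝ := max 1 (B - A) / (B - A)

/-- Lévy distance between Borel measures on `𝕀 = [A,B]`. -/
def dLevy (A B : ℝ) (μ ν : Measure ℝ) : ℝ :=
  omegaI A B * sInf {y : ℝ | 0 ≤ y ∧
    ∀ t : ℝ, cdf μ A B (t - y) - y ≤ cdf ν A B t ∧ cdf ν A B t ≤ cdf μ A B (t + y) + y}

/-- Kolmogorov (uniform) distance between Borel measures on `𝕀 = [A,B]`. -/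
def dKol (A B : ℝ) (μ ν : Measure ℝ) : ℝ :=
  sSup (Set.range fun t : ℝ => |cdf μ A B t - cdf ν A B t|)

/-- `L¹`-Kantorovich distance between Borel measures on `𝕀 = [A,B]`. -/
def dKant1 (A B : ℝ) (μ ν : Measure ℝ) : ℝ :=
  (B - A)⁻¹ * ∫ y in Ioo (0 : ℝ) 1, |quant μ A B y - quant ν A B y|

/-- `L^r`-Kantorovich distance between Borel measures on `𝕀 = [A,B]`. -/
def dKant (A B r : ℝ) (μ ν : Measure ℝ) : ℝ :=
  (B - A)⁻¹ * (∫ y in Ioo (0 : ℝ) 1, |quant μ A B y - quant ν A B y| ^ r) ^ (1 / r)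

/-- The Benford measure `β_b` on `[1,b]`: the law of `b^U` with `U` uniform on `[0,1)`. -/
def benford (b : ℝ) : Measure ℝ := (volume.restrict (Ico (0 : ℝ) 1)).map (fun t : ℝ => b ^ t)

/-- The map `T_{f,a}(x) = f₊(f⁻¹(x+a) + 2a) + a`. -/
def Tmap (f : ℝ → EReal) (a : ℝ) : EReal → EReal :=
  fun x => fplus f (upperInvE f (x + (a : EReal)) + ((2 * a : ℝ) : EReal)) + (a : EReal)

/-- The map `S_{f,a}(x) = f₊(f⁻¹(x+a)) + a`. -/
def Smap (f : ℝ → EReal) (a : ℝ) : EReal → EReal :=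
  fun x => fplus f (upperInvE f (x + (a : EReal))) + (a : EReal)

/-- `L_•^{•,n} = min {a ≥ 0 : T_{F_μ,a}^{[n]}(0) ≥ 1}`. -/
def LBB (μ : Measure ℝ) (A B : ℝ) (n : ℕ) : ℝ :=
  sInf {a : ℝ | 0 ≤ a ∧ (1 : EReal) ≤ (Tmap (cdfEReal μ A B) a)^[n] ((0 : ℝ) : EReal)}

/-- `K_•^{•,n} = min {a ≥ 0 : S_{F_μ,a}^{[n]}(0) ≥ 1}`. -/
def KBB (μ : Measure ℝ) (A B : ℝ) (n : ℕ) : ℝ :=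
  sInf {a : ℝ | 0 ≤ a ∧ (1 : EReal) ≤ (Smap (cdfEReal μ A B) a)^[n] ((0 : ℝ) : EReal)}


lemma psum_zero (n : ℕ) (p : Fin n → ℝ) : psum n p 0 = 0 := by
  simp [psum]

lemma psum_succ (n : ℕ) (p : Fin n → ℝ) (k : Fin n) :
    psum n p ((k : ℕ) + 1) = psum n p k + p k := by
  have hk : p k = ∑ j : Fin n, if j = k then p j else 0 := by simp
  rw [psum, psum, hk, ← Finset.sum_add_distrib]
  refine Finset.sum_congr rfl fun j _ => ?_
  rcases lt_trichotomy j k with h | h | h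
  · have h' : (j : ℕ) < k := h
    simp [h', h.ne, Nat.lt_succ_of_lt h']
  · subst h; simp
  · have h' : (k : ℕ) < j := h
    simp [h.ne', show ¬ ((j : ℕ) < k) by omega, show ¬ ((j : ℕ) < k + 1) by omega]

lemma psum_self (n : ℕ) (p : Fin n → ℝ) : psum n p n = ∑ j, p j := by
  simp [psum]

lemma psum_mono {n : ℕ} {p : Fin n → ℝ} (hp : ∀ j, 0 ≤ p j) : Monotone (psum n p) := by
  intro i k hik
  refine Finset.sum_le_sum fun j _ => ?_
  split_ifs <;> first | omega | simp [hp]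

lemma eq_of_psum_eq {n : ℕ} {p q : Fin n → ℝ} (h : ∀ k ≤ n, psum n p k = psum n q k) :
    p = q := by
  funext j
  have h1 := h j j.2.le
  have h2 := h (j + 1) j.2
  rw [psum_succ, psum_succ] at h2
  linarith

lemma discr_apply_toReal {n : ℕ} {y q : Fin n → ℝ} (hq : ∀ j, 0 ≤ q j) {S : Set ℝ}
    [DecidablePred (· ∈ S)] (hS : MeasurableSet S) :
    (discr n y q S).toReal = ∑ j, if y j ∈ S then q j else 0 := by
  rw [discr, Measure.finsetSum_apply, ENNReal.toReal_sum]
  · refine Finset.sum_congr rfl fun j _ => ?_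
    by_cases h : y j ∈ S <;> simp [h, hS, hq j]
  · intro j _
    by_cases h : y j ∈ S <;> simp [h, hS]

/-- The quantile function of `δ_y^q` equals `y_k` between consecutive partial sums of `q`. -/
lemma quant_discr {A B : ℝ} {n : ℕ} {y q : Fin n → ℝ} (hy : IsXi A B n y) (hq : IsPi n q)
    (k : Fin n) {t : ℝ} (ht : t ∈ Ico (psum n q k) (psum n q ((k : ℕ) + 1))) :
    quant (discr n y q) A B t = y k := by
  classical
  have ht0 : 0 ≤ t := by
    have := psum_mono hq.1 (Nat.zero_le k)
    rw [psum_zero] at this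
    exact this.trans ht.1
  have hA := discr_apply_toReal (y := y) hq.1 (measurableSet_singleton A)
  have hcdf (z : ℝ) := discr_apply_toReal (y := y) hq.1
    ((measurableSet_Icc (a := A) (b := B)).inter (measurableSet_Iic (a := z)))
  rw [quant]
  rcases (hy.1 k).1.eq_or_lt with hk | hk
  · rw [if_pos, hk]
    left
    rw [hA]
    refine ht.2.trans_le (Finset.sum_le_sum fun j _ => ?_)
    by_cases hj : (j : ℕ) < k + 1
    · have h1 : y j ≤ y k := hy.2 (Nat.lt_succ_iff.mp hj)
      have : y j ∈ ({A} : Set ℝ) := le_antisymm (h1.trans hk.ge) (hy.1 j).1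
      rw [if_pos hj, if_pos this]
    · rw [if_neg hj]
      split_ifs <;> simp [hq.1 j]
  · rw [if_neg]
    · refine csSup_eq_of_forall_le_of_forall_lt_exists_gt ?_ ?_ ?_
      · refine ⟨A, ⟨le_rfl, (hy.1 k).1.trans (hy.1 k).2⟩, ?_⟩
        rw [cdf, hcdf]
        refine le_trans (Finset.sum_le_sum fun j _ => ?_) ht.1
        by_cases hj : (j : ℕ) < k
        · rw [if_pos hj]
          split_ifs <;> simp [hq.1 j]
        · have h1 : y k ≤ y j := hy.2 (not_lt.mp hj)
          rw [if_neg hj, if_neg]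
          exact fun h => absurd h.2 (not_le.mpr (hk.trans_le h1))
      · rintro z ⟨hz, hzt⟩
        by_contra! hlt
        rw [cdf, hcdf] at hzt
        refine absurd (ht.2.trans_le (le_trans (Finset.sum_le_sum fun j _ => ?_) hzt)) (lt_irrefl _)
        by_cases hj : (j : ℕ) < k + 1
        · have h1 : y j ≤ y k := hy.2 (Nat.lt_succ_iff.mp hj)
          rw [if_pos hj, if_pos]
          exact ⟨hy.1 j, h1.trans hlt.le⟩
        · rw [if_neg hj]
          split_ifs <;> simp [hq.1 j]
      · intro w hw
        obtain ⟨z, hz1, hz2⟩ := exists_between (max_lt hw hk)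
        refine ⟨z, ⟨⟨(le_max_right _ _).trans hz1.le, hz2.le.trans (hy.1 k).2⟩, ?_⟩,
          (le_max_left _ _).trans_lt hz1⟩
        rw [cdf, hcdf]
        refine le_trans (Finset.sum_le_sum fun j _ => ?_) ht.1
        by_cases hj : (j : ℕ) < k
        · rw [if_pos hj]
          split_ifs <;> simp [hq.1 j]
        · have h1 : y k ≤ y j := hy.2 (not_lt.mp hj)
          rw [if_neg hj, if_neg]
          exact fun h => absurd h.2 (not_le.mpr (hz2.trans_le h1))
    · rintro (h | h)
      · rw [hA] at h
        refine absurd (h.trans_le' ht.1) (not_lt.mpr (Finset.sum_le_sum fun j _ => ?_))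
        by_cases hj : (j : ℕ) < k
        · rw [if_pos hj]
          split_ifs <;> simp [hq.1 j]
        · have h1 : y k ≤ y j := hy.2 (not_lt.mp hj)
          rw [if_neg hj, if_neg]
          exact (hk.trans_le h1).ne'
      · exact absurd ht0 (not_le.mpr h)

lemma benford_apply (b : ℝ) (hb : 1 < b) {S : Set ℝ} (hS : MeasurableSet S) :
    benford b S = volume ((fun t : ℝ => b ^ t) ⁻¹' S ∩ Ico 0 1) := by
  have hm : Measurable fun t : ℝ => b ^ t :=
    (Real.continuous_const_rpow (by positivity)).measurable
  rw [benford, Measure.map_apply hm hS, Measure.restrict_apply (hm hS)]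

lemma cdf_benford {b : ℝ} (hb : 1 < b) {u : ℝ} (hu : u ∈ Icc (0 : ℝ) 1) :
    cdf (benford b) 1 b (b ^ u) = u := by
  rw [cdf, benford_apply b hb (measurableSet_Icc.inter measurableSet_Iic)]
  have hset : (fun t : ℝ => b ^ t) ⁻¹' (Icc 1 b ∩ Iic (b ^ u)) ∩ Ico 0 1 = Iic u ∩ Ico 0 1 := by
    ext t
    simp only [mem_inter_iff, mem_preimage, mem_Icc, mem_Iic, mem_Ico,
      Real.rpow_le_rpow_left_iff hb]
    constructor
    · tauto
    · rintro ⟨h, h0, h1⟩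
      refine ⟨⟨⟨Real.one_le_rpow hb.le h0, ?_⟩, h⟩, h0, h1⟩
      simpa using Real.rpow_le_rpow_of_exponent_le hb.le h1.le
  have hvol : volume (Iic u ∩ Ico (0 : ℝ) 1) = ENNReal.ofReal u := by
    refine le_antisymm ?_ ?_
    · calc volume (Iic u ∩ Ico (0 : ℝ) 1) ≤ volume (Icc 0 u) :=
            measure_mono fun t ht => ⟨ht.2.1, ht.1⟩
        _ = _ := by simp
    · calc ENNReal.ofReal u = volume (Ico 0 u) := by simp
        _ ≤ volume (Iic u ∩ Ico (0 : ℝ) 1) :=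
            measure_mono fun t ht => ⟨ht.2.le, ht.1, ht.2.trans_le hu.2⟩
  rw [hset, hvol, ENNReal.toReal_ofReal hu.1]

lemma quant_benford {b : ℝ} (hb : 1 < b) {t : ℝ} (ht : t ∈ Ioo (0 : ℝ) 1) :
    quant (benford b) 1 b t = b ^ t := by
  have hb0 : 0 < b := by positivity
  have hone : (benford b {1}).toReal = 0 := by
    rw [benford_apply b hb (measurableSet_singleton _)]
    have : volume ((fun t : ℝ => b ^ t) ⁻¹' {1} ∩ Ico 0 1) = 0 := by
      refine measure_mono_null (t := {0}) ?_ (by simp)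
      rintro s ⟨hs, hs0, -⟩
      by_contra hne
      exact (Real.one_lt_rpow hb (lt_of_le_of_ne hs0 (Ne.symm hne))).ne' hs
    simp [this]
  have hmem {u : ℝ} (hu : u ∈ Icc (0 : ℝ) 1) : b ^ u ∈ Icc 1 b :=
    ⟨Real.one_le_rpow hb.le hu.1, by simpa using Real.rpow_le_rpow_of_exponent_le hb.le hu.2⟩
  rw [quant, if_neg (by rw [hone]; simp [ht.1.le])]
  refine IsGreatest.csSup_eq ⟨⟨hmem ⟨ht.1.le, ht.2.le⟩, ?_⟩, ?_⟩
  · rw [cdf_benford hb ⟨ht.1.le, ht.2.le⟩]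
  · rintro z ⟨hz, hzt⟩
    have hz0 : 0 < z := by linarith [hz.1]
    have hzb : b ^ Real.logb b z = z := Real.rpow_logb hb0 hb.ne' hz0
    have h0 : 0 ≤ Real.logb b z := Real.logb_nonneg hb hz.1
    have h1 : Real.logb b z ≤ 1 := by
      rw [← hzb] at hz
      have := hz.2
      nth_rw 3 [← Real.rpow_one b] at this
      exact (Real.rpow_le_rpow_left_iff hb).mp this
    rw [← hzb, cdf_benford hb ⟨h0, h1⟩] at hzt
    rw [← hzb]
    exact Real.rpow_le_rpow_of_exponent_le hb.le hzt

/-- The distance of `β_b` to `δ_y^q` splits over the intervals between partial sums of `q`. -/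
lemma dKant1_benford_discr {b : ℝ} (hb : 1 < b) {n : ℕ} {y q : Fin n → ℝ}
    (hy : IsXi 1 b n y) (hq : IsPi n q) :
    dKant1 1 b (benford b) (discr n y q) =
      (b - 1)⁻¹ * ∑ k : Fin n, ∫ t in psum n q k..psum n q ((k : ℕ) + 1), |b ^ t - y k| := by
  have hmono := psum_mono hq.1
  have h0 := psum_zero n q
  have h1 : psum n q n = 1 := (psum_self n q).trans hq.2
  have hcont : Continuous fun t : ℝ => b ^ t := Real.continuous_const_rpow (by positivity)
  have heq (k : Fin n) : ∀ t ∈ Ioo (psum n q k) (psum n q ((k : ℕ) + 1)),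
      |quant (benford b) 1 b t - quant (discr n y q) 1 b t| = |b ^ t - y k| := by
    intro t ht
    have ha : 0 ≤ psum n q k := h0 ▸ hmono (Nat.zero_le _)
    have hc : psum n q ((k : ℕ) + 1) ≤ 1 := h1 ▸ hmono k.2
    rw [quant_benford hb ⟨ha.trans_lt ht.1, ht.2.trans_le hc⟩,
      quant_discr hy hq k ⟨ht.1.le, ht.2⟩]
  rw [dKant1, ← integral_Ioc_eq_integral_Ioo, ← intervalIntegral.integral_of_le zero_le_one]
  congr 1
  have hint : ∀ k < n, IntervalIntegrable
      (fun t => |quant (benford b) 1 b t - quant (discr n y q) 1 b t|) volume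
      (psum n q k) (psum n q (k + 1)) := by
    intro k hk
    rw [intervalIntegrable_iff_integrableOn_Ioo_of_le (hmono k.le_succ)]
    refine IntegrableOn.congr_fun (f := fun t => |b ^ t - y ⟨k, hk⟩|) ?_
      (fun t ht => (heq ⟨k, hk⟩ t ht).symm) measurableSet_Ioo
    rw [← intervalIntegrable_iff_integrableOn_Ioo_of_le (hmono k.le_succ)]
    exact (hcont.sub continuous_const).abs.intervalIntegrable _ _
  have hsum := intervalIntegral.sum_integral_adjacent_intervals hint
  rw [h0, h1] at hsum
  rw [← hsum, Finset.sum_range]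
  refine Finset.sum_congr rfl fun k _ => ?_
  rw [intervalIntegral.integral_of_le (hmono (Nat.le_succ _)), integral_Ioc_eq_integral_Ioo,
    intervalIntegral.integral_of_le (hmono (Nat.le_succ _)), integral_Ioc_eq_integral_Ioo]
  exact setIntegral_congr_fun measurableSet_Ioo (heq k)

lemma integral_const_rpow {b : ℝ} (hb : 1 < b) (u v : ℝ) :
    ∫ t in u..v, b ^ t = (b ^ v - b ^ u) / Real.log b := by
  have hlog : Real.log b ≠ 0 := (Real.log_pos hb).ne'
  have hb0 : 0 < b := by positivity
  rw [intervalIntegral.integral_eq_sub_of_hasDerivAt (f := fun t => b ^ t / Real.log b)]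
  · ring
  · intro t _
    have h := (Real.hasStrictDerivAt_const_rpow hb0 t).hasDerivAt.div_const (Real.log b)
    rwa [mul_div_cancel_right₀ _ hlog] at h
  · exact (Real.continuous_const_rpow hb0.ne').intervalIntegrable _ _

/-- The signed integral of `b ^ t - z`, with the sign changing at the midpoint of `[u, v]`. -/
lemma integral_signed_const_rpow_sub {b : ℝ} (hb : 1 < b) (u v z : ℝ) :
    (∫ t in u..(u + v) / 2, (z - b ^ t)) + ∫ t in (u + v) / 2..v, (b ^ t - z) =
      (b ^ (v / 2) - b ^ (u / 2)) ^ 2 / Real.log b := by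
  have hb0 : 0 < b := by positivity
  have hint (c d : ℝ) : IntervalIntegrable (fun t : ℝ => b ^ t) volume c d :=
    (Real.continuous_const_rpow hb0.ne').intervalIntegrable _ _
  rw [intervalIntegral.integral_sub (by simp) (hint _ _),
    intervalIntegral.integral_sub (hint _ _) (by simp), integral_const_rpow hb,
    integral_const_rpow hb, intervalIntegral.integral_const, intervalIntegral.integral_const]
  have hm : b ^ ((u + v) / 2) = b ^ (u / 2) * b ^ (v / 2) := by
    rw [← Real.rpow_add hb0]; ring_nf
  have hu : b ^ u = b ^ (u / 2) * b ^ (u / 2) := by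
    rw [← Real.rpow_add hb0]; ring_nf
  have hv : b ^ v = b ^ (v / 2) * b ^ (v / 2) := by
    rw [← Real.rpow_add hb0]; ring_nf
  rw [hm, hu, hv]
  simp only [smul_eq_mul]
  ring

lemma integral_abs_const_rpow_sub_split {b : ℝ} (hb : 1 < b) (u v z : ℝ) :
    ∫ t in u..v, |b ^ t - z| =
      (∫ t in u..(u + v) / 2, |b ^ t - z|) + ∫ t in (u + v) / 2..v, |b ^ t - z| := by
  have hcont : Continuous fun t : ℝ => |b ^ t - z| :=
    ((Real.continuous_const_rpow (by positivity)).sub continuous_const).abs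
  exact (intervalIntegral.integral_add_adjacent_intervals (hcont.intervalIntegrable _ _)
    (hcont.intervalIntegrable _ _)).symm

lemma sq_div_log_le_integral_abs {b : ℝ} (hb : 1 < b) {u v : ℝ} (huv : u ≤ v) (z : ℝ) :
    (b ^ (v / 2) - b ^ (u / 2)) ^ 2 / Real.log b ≤ ∫ t in u..v, |b ^ t - z| := by
  have hcont : Continuous fun t : ℝ => b ^ t := Real.continuous_const_rpow (by positivity)
  rw [← integral_signed_const_rpow_sub hb u v z, integral_abs_const_rpow_sub_split hb]
  refine add_le_add (intervalIntegral.integral_mono (by linarith) ?_ ?_ fun t => ?_)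
    (intervalIntegral.integral_mono (by linarith) ?_ ?_ fun t => le_abs_self _)
  any_goals exact Continuous.intervalIntegrable (by fun_prop) _ _
  rw [abs_sub_comm]
  exact le_abs_self _

lemma integral_abs_const_rpow_sub_midpoint {b : ℝ} (hb : 1 < b) {u v : ℝ} (huv : u ≤ v) :
    ∫ t in u..v, |b ^ t - b ^ ((u + v) / 2)| =
      (b ^ (v / 2) - b ^ (u / 2)) ^ 2 / Real.log b := by
  rw [← integral_signed_const_rpow_sub hb u v (b ^ ((u + v) / 2)),
    integral_abs_const_rpow_sub_split hb]
  congr 1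
  · refine intervalIntegral.integral_congr fun t ht => ?_
    rw [uIcc_of_le (by linarith)] at ht
    have := Real.rpow_le_rpow_of_exponent_le hb.le ht.2
    rw [abs_of_nonpos (by linarith)]
    ring
  · refine intervalIntegral.integral_congr fun t ht => ?_
    rw [uIcc_of_le (by linarith)] at ht
    have := Real.rpow_le_rpow_of_exponent_le hb.le ht.1
    rw [abs_of_nonneg (by linarith)]

lemma eq_midpoint_of_integral_abs_eq {b : ℝ} (hb : 1 < b) {u v z : ℝ} (huv : u < v)
    (h : ∫ t in u..v, |b ^ t - z| = (b ^ (v / 2) - b ^ (u / 2)) ^ 2 / Real.log b) :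
    z = b ^ ((u + v) / 2) := by
  have hcont : Continuous fun t : ℝ => b ^ t := Real.continuous_const_rpow (by positivity)
  rw [← integral_signed_const_rpow_sub hb u v z, integral_abs_const_rpow_sub_split hb] at h
  have hl : ∫ t in u..(u + v) / 2, (z - b ^ t) ≤ ∫ t in u..(u + v) / 2, |b ^ t - z| := by
    refine intervalIntegral.integral_mono (by linarith) ?_ ?_ fun t => ?_
    any_goals exact Continuous.intervalIntegrable (by fun_prop) _ _
    rw [abs_sub_comm]
    exact le_abs_self _
  have hr : ∫ t in (u + v) / 2..v, (b ^ t - z) ≤ ∫ t in (u + v) / 2..v, |b ^ t - z| := by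
    refine intervalIntegral.integral_mono (by linarith) ?_ ?_ fun t => le_abs_self _
    all_goals exact Continuous.intervalIntegrable (by fun_prop) _ _
  rcases lt_trichotomy z (b ^ ((u + v) / 2)) with hz | hz | hz
  · refine absurd ?_ (not_lt.mpr (show ∫ t in u..(u + v) / 2, |b ^ t - z| ≤
      ∫ t in u..(u + v) / 2, (z - b ^ t) by linarith))
    refine intervalIntegral.integral_lt_integral_of_continuousOn_of_le_of_exists_lt
      (by linarith) (by fun_prop) (by fun_prop) (fun t _ => ?_)
      ⟨(u + v) / 2, ⟨by linarith, le_rfl⟩, ?_⟩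
    · rw [abs_sub_comm]
      exact le_abs_self _
    · rw [abs_of_pos (by linarith)]
      linarith
  · exact hz
  · refine absurd ?_ (not_lt.mpr (show ∫ t in (u + v) / 2..v, |b ^ t - z| ≤
      ∫ t in (u + v) / 2..v, (b ^ t - z) by linarith))
    refine intervalIntegral.integral_lt_integral_of_continuousOn_of_le_of_exists_lt
      (by linarith) (by fun_prop) (by fun_prop) (fun t _ => le_abs_self _)
      ⟨(u + v) / 2, ⟨le_rfl, by linarith⟩, ?_⟩
    rw [abs_of_neg (by linarith)]
    linarith

/-- The variance identity for the increments of a finite sequence. -/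
lemma sum_sq_increments (n : ℕ) (hn : 0 < n) (σ : ℕ → ℝ) :
    ∑ k : Fin n, (σ ((k : ℕ) + 1) - σ k) ^ 2 = (σ n - σ 0) ^ 2 / n +
      ∑ k : Fin n, (σ ((k : ℕ) + 1) - σ k - (σ n - σ 0) / n) ^ 2 := by
  have hn' : (n : ℝ) ≠ 0 := by positivity
  have htel : ∑ k : Fin n, (σ ((k : ℕ) + 1) - σ k) = σ n - σ 0 := by
    rw [Fin.sum_univ_eq_sum_range fun k => σ (k + 1) - σ k, Finset.sum_range_sub]
  have hexp (k : Fin n) : (σ ((k : ℕ) + 1) - σ k - (σ n - σ 0) / n) ^ 2 =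
      (σ ((k : ℕ) + 1) - σ k) ^ 2 - 2 * ((σ n - σ 0) / n) * (σ ((k : ℕ) + 1) - σ k) +
        ((σ n - σ 0) / n) ^ 2 := by ring
  simp only [hexp, Finset.sum_add_distrib, Finset.sum_sub_distrib, ← Finset.mul_sum]
  rw [← Finset.sum_sub_distrib, htel]
  simp only [Finset.sum_const, Finset.card_univ, Fintype.card_fin, nsmul_eq_mul]
  field_simp
  ring

lemma eq_arith_of_increments_eq {n : ℕ} {σ : ℕ → ℝ} {d : ℝ}
    (h : ∀ k < n, σ (k + 1) - σ k = d) : ∀ k ≤ n, σ k = σ 0 + k * d := by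
  intro k
  induction k with
  | zero => simp
  | succ k ih =>
    intro hk
    have := h k hk
    have := ih (by omega)
    push_cast
    linarith

lemma sqrt_sub_one_sq_div {b : ℝ} (hb : 1 < b) (n : ℕ) :
    (b - 1)⁻¹ * ((Real.sqrt b - 1) ^ 2 / n / Real.log b) =
      1 / ((n : ℝ) * Real.log b) * Real.tanh (Real.log b / 4) := by
  have hb0 : 0 < b := by positivity
  have hs : 1 < Real.sqrt b := by simpa using Real.sqrt_lt_sqrt zero_le_one hb
  have hsq : Real.sqrt b ^ 2 = b := Real.sq_sqrt hb0.le
  have htanh : Real.tanh (Real.log b / 4) = (Real.sqrt b - 1) / (Real.sqrt b + 1) := by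
    have he : Real.exp (Real.log b / 4) ^ 2 = Real.sqrt b := by
      rw [Real.sqrt_eq_rpow, Real.rpow_def_of_pos hb0, ← Real.exp_nat_mul]
      congr 1
      push_cast
      ring
    have hpos := Real.exp_pos (Real.log b / 4)
    rw [Real.tanh_eq_sinh_div_cosh, Real.sinh_eq, Real.cosh_eq, Real.exp_neg, ← he]
    field_simp
  have hb1 : b - 1 = (Real.sqrt b - 1) * (Real.sqrt b + 1) := by linear_combination -hsq
  have h1 : Real.sqrt b - 1 ≠ 0 := by linarith
  have h2 : Real.sqrt b + 1 ≠ 0 := by linarith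
  rw [htanh, hb1]
  field_simp

/-- The distance of `β_b` to `δ_y^q` is at least the optimal value, with a gap controlled by
nonnegative terms; equality forces the increments of `b ^ (Q / 2)` to be constant and each
location to sit at the midpoint. -/
lemma le_dKant1_benford_discr {b : ℝ} (hb : 1 < b) {n : ℕ} (hn : 0 < n) {y q : Fin n → ℝ}
    (hy : IsXi 1 b n y) (hq : IsPi n q) :
    (b - 1)⁻¹ * ((Real.sqrt b - 1) ^ 2 / n / Real.log b) ≤
        dKant1 1 b (benford b) (discr n y q) ∧
      (dKant1 1 b (benford b) (discr n y q) =
          (b - 1)⁻¹ * ((Real.sqrt b - 1) ^ 2 / n / Real.log b) →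
        (∀ k ≤ n, b ^ (psum n q k / 2) = 1 + (k : ℝ) / n * (Real.sqrt b - 1)) ∧
        ∀ k : Fin n, psum n q k < psum n q ((k : ℕ) + 1) →
          y k = b ^ ((psum n q k + psum n q ((k : ℕ) + 1)) / 2)) := by
  have hlog : 0 < Real.log b := Real.log_pos hb
  have hinv : 0 < (b - 1)⁻¹ := inv_pos.mpr (by linarith)
  have hmono := psum_mono hq.1
  set σ : ℕ → ℝ := fun k => b ^ (psum n q k / 2) with hσ
  have hσ0 : σ 0 = 1 := by simp [hσ, psum_zero]
  have hσn : σ n = Real.sqrt b := by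
    simp [hσ, psum_self, hq.2, Real.sqrt_eq_rpow]
  have hterm (k : Fin n) : (σ ((k : ℕ) + 1) - σ k) ^ 2 / Real.log b ≤
      ∫ t in psum n q k..psum n q ((k : ℕ) + 1), |b ^ t - y k| :=
    sq_div_log_le_integral_abs hb (hmono (Nat.le_succ _)) _
  have hsum := Finset.sum_le_sum fun k (_ : k ∈ Finset.univ) => hterm k
  have hvar := sum_sq_increments n hn σ
  rw [hσ0, hσn] at hvar
  have hnonneg : 0 ≤ ∑ k : Fin n,
      (σ ((k : ℕ) + 1) - σ k - (Real.sqrt b - 1) / n) ^ 2 :=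
    Finset.sum_nonneg fun _ _ => sq_nonneg _
  have hle : (Real.sqrt b - 1) ^ 2 / n / Real.log b ≤
      ∑ k : Fin n, (σ ((k : ℕ) + 1) - σ k) ^ 2 / Real.log b := by
    rw [← Finset.sum_div, hvar]
    gcongr
    linarith
  rw [dKant1_benford_discr hb hy hq]
  refine ⟨mul_le_mul_of_nonneg_left (hle.trans hsum) hinv.le, fun heq => ?_⟩
  have heq' := mul_left_cancel₀ hinv.ne' heq
  constructor
  · have hzero : ∑ k : Fin n,
        (σ ((k : ℕ) + 1) - σ k - (Real.sqrt b - 1) / n) ^ 2 = 0 := by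
      rw [heq', ← Finset.sum_div, div_le_div_iff_of_pos_right hlog, hvar] at hsum
      linarith
    rw [Finset.sum_eq_zero_iff_of_nonneg fun _ _ => sq_nonneg _] at hzero
    intro k hk
    have := eq_arith_of_increments_eq (σ := σ) (d := (Real.sqrt b - 1) / n)
      (fun j hj => by
        have := pow_eq_zero_iff two_ne_zero |>.mp (hzero ⟨j, hj⟩ (Finset.mem_univ _))
        exact sub_eq_zero.mp this) k hk
    rw [hσ0] at this
    rw [show b ^ (psum n q k / 2) = σ k from rfl, this]
    ring
  · intro k hk
    have hall := (Finset.sum_eq_sum_iff_of_le fun k (_ : k ∈ Finset.univ) => hterm k).mp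
      (le_antisymm hsum (heq'.trans_le hle))
    exact eq_midpoint_of_integral_abs_eq hb hk (hall k (Finset.mem_univ _)).symm

/-- Cor. 4.3: the unique best (unconstrained) `d_1`-approximation of the
Benford measure `β_b` with at most `n` atoms, given by explicit formulas, and its distance
`(1/(n log b))·tanh(log b/4)`. -/
theorem best_dKant1_benford (b : ℝ) (hb : 1 < b) (n : ℕ) (hn : 0 < n)
    (x p : Fin n → ℝ)
    (hxdef : ∀ j : Fin n, x j =
      (1 + (j : ℝ) / (n : ℝ) * (Real.sqrt b - 1)) *
        (1 + ((j : ℝ) + 1) / (n : ℝ) * (Real.sqrt b - 1)))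
    (hPdef : ∀ j : Fin n, psum n p ((j : ℕ) + 1) =
      2 / Real.log b * Real.log (1 + ((j : ℝ) + 1) / (n : ℝ) * (Real.sqrt b - 1))) :
    IsXi 1 b n x ∧ IsPi n p ∧
    (∀ y q : Fin n → ℝ, IsXi 1 b n y → IsPi n q →
      dKant1 1 b (benford b) (discr n x p) ≤ dKant1 1 b (benford b) (discr n y q)) ∧
    (∀ y q : Fin n → ℝ, IsXi 1 b n y → IsPi n q →
      (∀ y' q' : Fin n → ℝ, IsXi 1 b n y' → IsPi n q' →
        dKant1 1 b (benford b) (discr n y q) ≤ dKant1 1 b (benford b) (discr n y' q')) →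
      discr n y q = discr n x p) ∧
    (Set.range x).ncard = n ∧
    dKant1 1 b (benford b) (discr n x p) =
      1 / ((n : ℝ) * Real.log b) * Real.tanh (Real.log b / 4) := by
  have hb0 : 0 < b := by positivity
  have hn' : (0 : ℝ) < n := by exact_mod_cast hn
  have hlog : 0 < Real.log b := Real.log_pos hb
  have hs : 1 < Real.sqrt b := by simpa using Real.sqrt_lt_sqrt zero_le_one hb
  have hsq : Real.sqrt b * Real.sqrt b = b := Real.mul_self_sqrt hb0.le
  set s : ℕ → ℝ := fun k => 1 + (k : ℝ) / n * (Real.sqrt b - 1) with hsdef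
  have hs0 : s 0 = 1 := by simp [hsdef]
  have hsn : s n = Real.sqrt b := by
    simp only [hsdef]
    rw [div_self hn'.ne']
    ring
  have hsmono : StrictMono s := by
    intro i k hik
    have : (i : ℝ) < k := by exact_mod_cast hik
    have h1 : 0 < Real.sqrt b - 1 := by linarith
    simp only [hsdef]
    gcongr
  have hs1 (k : ℕ) : 1 ≤ s k := hs0 ▸ hsmono.monotone (Nat.zero_le k)
  have hspos (k : ℕ) : 0 < s k := by linarith [hs1 k]
  have hxs (j : Fin n) : x j = s j * s ((j : ℕ) + 1) := by
    rw [hxdef j]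
    simp only [hsdef]
    push_cast
    ring
  have hP : ∀ k ≤ n, psum n p k = 2 / Real.log b * Real.log (s k) := by
    intro k hk
    rcases k with - | k
    · rw [psum_zero, hs0, Real.log_one, mul_zero]
    · rw [hPdef ⟨k, hk⟩]
      simp [hsdef]
  have hPσ : ∀ k ≤ n, b ^ (psum n p k / 2) = s k := by
    intro k hk
    rw [hP k hk, Real.rpow_def_of_pos hb0]
    rw [show Real.log b * (2 / Real.log b * Real.log (s k) / 2) = Real.log (s k) by field_simp,
      Real.exp_log (hspos k)]
  have hxmid (j : Fin n) : x j = b ^ ((psum n p j + psum n p ((j : ℕ) + 1)) / 2) := by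
    rw [add_div, Real.rpow_add hb0, hPσ _ j.2.le, hPσ _ j.2, hxs]
  have hxmono : StrictMono x := by
    intro i j hij
    have h1 : s i < s j := hsmono hij
    have h2 : s ((i : ℕ) + 1) < s ((j : ℕ) + 1) := hsmono (Nat.succ_lt_succ hij)
    rw [hxs, hxs]
    exact mul_lt_mul'' h1 h2 (hspos _).le (hspos _).le
  have hX : IsXi 1 b n x := by
    refine ⟨fun j => ?_, hxmono.monotone⟩
    rw [hxs]
    refine ⟨one_le_mul_of_one_le_of_one_le (hs1 _) (hs1 _), ?_⟩
    rw [← hsq, ← hsn]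
    exact mul_le_mul (hsmono.monotone j.2.le) (hsmono.monotone j.2) (hspos _).le (hspos _).le
  have hpsum_lt (j : Fin n) : psum n p j < psum n p ((j : ℕ) + 1) := by
    rw [hP _ j.2.le, hP _ j.2]
    have := Real.log_lt_log (hspos j) (hsmono (Nat.lt_succ_self (j : ℕ)))
    gcongr
  have hPi : IsPi n p := by
    refine ⟨fun j => ?_, ?_⟩
    · have := hpsum_lt j
      rw [psum_succ] at this
      linarith
    · rw [← psum_self, hP n le_rfl, hsn, Real.log_sqrt hb0.le]
      field_simp
  have hval : dKant1 1 b (benford b) (discr n x p) =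
      (b - 1)⁻¹ * ((Real.sqrt b - 1) ^ 2 / n / Real.log b) := by
    rw [dKant1_benford_discr hb hX hPi]
    congr 1
    have (k : Fin n) : ∫ t in psum n p k..psum n p ((k : ℕ) + 1), |b ^ t - x k| =
        ((Real.sqrt b - 1) / n) ^ 2 / Real.log b := by
      rw [hxmid k, integral_abs_const_rpow_sub_midpoint hb (hpsum_lt k).le, hPσ _ k.2.le,
        hPσ _ k.2]
      simp only [hsdef]
      push_cast
      ring
    simp only [this, Finset.sum_const, Finset.card_univ, Fintype.card_fin, nsmul_eq_mul]
    field_simp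
  refine ⟨hX, hPi, fun y q hy hq => ?_, fun y q hy hq hmin => ?_, ?_, ?_⟩
  · rw [hval]
    exact (le_dKant1_benford_discr hb hn hy hq).1
  · obtain ⟨hle, heq⟩ := le_dKant1_benford_discr hb hn hy hq
    obtain ⟨hQ, hY⟩ := heq (le_antisymm ((hmin x p hX hPi).trans_eq hval) hle)
    have hqp : q = p := eq_of_psum_eq fun k hk => by
      have h := (hQ k hk).trans (hPσ k hk).symm
      have := Real.rpow_right_inj hb0 hb.ne' |>.mp h
      linarith
    subst hqp
    have hyx : y = x := funext fun k => (hY k (hpsum_lt k)).trans (hxmid k).symm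
    rw [hyx]
  · rw [← Set.image_univ, Set.ncard_image_of_injective _ hxmono.injective, Set.ncard_univ,
      Nat.card_eq_fintype_card, Fintype.card_fin]
  · rw [hval, sqrt_sub_one_sq_div hb]

end BenfordApprox
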